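/- There exist no (D,ν) ∈ {(2,2),(2,4),(4,8)} and integers t₁,t₂,t₃,t₄ with gcd(t₁,t₂,t₃,t₄) = 1 and d₂ := |t₁t₄ − t₂t₃| ≠ 0 such that the four subgroups of ℤ² defined by Λ₀ := {(x₁,x₂) : x₁ ≡ 0 (mod D) and νx₂ ≡ 0 (mod D)}; Λ₁ := {(x₁,x₂) : (t₁t₂+t₃t₄)x₁ + (t₂²+t₄²)x₂ ≡ 0 (mod d₂D) and ν((t₁²+t₃²)x₁ + (t₁t₂+t₃t₄)x₂) ≡ 0 (mod d₂D)}; Λ₂ := {(x₁,x₂) : (t₃t₄−t₁t₂)x₁ + (t₄²−t₂²)x₂ ≡ 0 (mod d₂D) and ν((t₁²−t₃²)x₁ + (t₁t₂−t₃t₄)x₂) ≡ 0 (mod d₂D)}; Λ₃ := {(x₁,x₂) : (t₂t₃+t₁t₄)x₁ + 2t₂t₄x₂ ≡ 0 (mod d₂D) and ν(2t₁t₃x₁ + (t₂t₃+t₁t₄)x₂) ≡ 0 (mod d₂D)} satisfy simultaneously Λ₀ ∪ Λ₁ ∪ Λ₂ ∪ Λ₃ = ℤ² and Λᵢ ≠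 ℤ² for all i ∈ {0,1,2,3}. -/

import Mathlib

/-- The sublattice of ℤ² defined by the congruence `a·x₁ + b·x₂ ≡ 0 (mod n)`. -/
def congLat (a b n : ℤ) : AddSubgroup (ℤ × ℤ) where
  carrier := {p : ℤ × ℤ | n ∣ a * p.1 + b * p.2}
  zero_mem' := by simp
  add_mem' := by
    intro p q hp hq
    simp only [Set.mem_setOf_eq, Prod.fst_add, Prod.snd_add] at *
    have e : a * (p.1 + q.1) + b * (p.2 + q.2)
        = (a * p.1 + b * p.2) + (a * q.1 + b * q.2) := by ring
    rw [e]; exact dvd_add hp hq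
  neg_mem' := by
    intro p hp
    simp only [Set.mem_setOf_eq, Prod.fst_neg, Prod.snd_neg] at *
    have e : a * (-p.1) + b * (-p.2) = -(a * p.1 + b * p.2) := by ring
    rw [e]; exact hp.neg_right

/-- `Λ₀ = {(x₁,x₂) : x₁ ≡ 0 (mod D), ν·x₂ ≡ 0 (mod D)}`. -/
def Lam0 (D ν : ℤ) : AddSubgroup (ℤ × ℤ) := congLat 1 0 D ⊓ congLat 0 ν D

/-- `Λ₁`, cut out by `(t₁t₂+t₃t₄)x₁ + (t₂²+t₄²)x₂ ≡ 0` and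
`ν((t₁²+t₃²)x₁ + (t₁t₂+t₃t₄)x₂) ≡ 0 (mod d₂D)`, where `d₂ = |t₁t₄ - t₂t₃|`. -/
def Lam1 (D ν t1 t2 t3 t4 : ℤ) : AddSubgroup (ℤ × ℤ) :=
  congLat (t1 * t2 + t3 * t4) (t2 ^ 2 + t4 ^ 2) (|t1 * t4 - t2 * t3| * D) ⊓
    congLat (ν * (t1 ^ 2 + t3 ^ 2)) (ν * (t1 * t2 + t3 * t4)) (|t1 * t4 - t2 * t3| * D)

/-- `Λ₂`, cut out by `(t₃t₄-t₁t₂)x₁ + (t₄²-t₂²)x₂ ≡ 0` and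
`ν((t₁²-t₃²)x₁ + (t₁t₂-t₃t₄)x₂) ≡ 0 (mod d₂D)`. -/
def Lam2 (D ν t1 t2 t3 t4 : ℤ) : AddSubgroup (ℤ × ℤ) :=
  congLat (t3 * t4 - t1 * t2) (t4 ^ 2 - t2 ^ 2) (|t1 * t4 - t2 * t3| * D) ⊓
    congLat (ν * (t1 ^ 2 - t3 ^ 2)) (ν * (t1 * t2 - t3 * t4)) (|t1 * t4 - t2 * t3| * D)

/-- `Λ₃`, cut out by `(t₂t₃+t₁t₄)x₁ + 2t₂t₄x₂ ≡ 0` and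
`ν(2t₁t₃x₁ + (t₂t₃+t₁t₄)x₂) ≡ 0 (mod d₂D)`. -/
def Lam3 (D ν t1 t2 t3 t4 : ℤ) : AddSubgroup (ℤ × ℤ) :=
  congLat (t2 * t3 + t1 * t4) (2 * t2 * t4) (|t1 * t4 - t2 * t3| * D) ⊓
    congLat (ν * (2 * t1 * t3)) (ν * (t2 * t3 + t1 * t4)) (|t1 * t4 - t2 * t3| * D)

def CC1 (D ν t1 t2 t3 t4 x y : ℤ) : Prop :=
  (t1 * t4 - t2 * t3) * D ∣ (t1 * t2 + t3 * t4) * x + (t2 ^ 2 + t4 ^ 2) * y ∧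
  (t1 * t4 - t2 * t3) * D ∣ ν * (t1 ^ 2 + t3 ^ 2) * x + ν * (t1 * t2 + t3 * t4) * y

def CC2 (D ν t1 t2 t3 t4 x y : ℤ) : Prop :=
  (t1 * t4 - t2 * t3) * D ∣ (t3 * t4 - t1 * t2) * x + (t4 ^ 2 - t2 ^ 2) * y ∧
  (t1 * t4 - t2 * t3) * D ∣ ν * (t1 ^ 2 - t3 ^ 2) * x + ν * (t1 * t2 - t3 * t4) * y

def CC3 (D ν t1 t2 t3 t4 x y : ℤ) : Prop :=
  (t1 * t4 - t2 * t3) * D ∣ (t2 * t3 + t1 * t4) * x + (2 * t2 * t4) * y ∧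
  (t1 * t4 - t2 * t3) * D ∣ ν * (2 * t1 * t3) * x + ν * (t2 * t3 + t1 * t4) * y

theorem odd_of_dvd_aux {m n : ℤ} (hn : Odd n) (h : m ∣ n) : Odd m := by
  obtain ⟨k, rfl⟩ := h
  exact (Int.odd_mul.1 hn).1

/-- Linear combinations of solutions of a linear congruence. -/
theorem lin_dvd {n a b x y x' y' : ℤ} (r s : ℤ) (h : n ∣ a * x + b * y)
    (h' : n ∣ a * x' + b * y') : n ∣ a * (r * x + s * x') + b * (r * y + s * y') := by
  have := dvd_add (h.mul_left r) (h'.mul_left s)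
  exact this.trans (dvd_of_eq (by ring))

theorem CC1.lin {D ν t1 t2 t3 t4 x y x' y' : ℤ} (r s : ℤ) (h : CC1 D ν t1 t2 t3 t4 x y)
    (h' : CC1 D ν t1 t2 t3 t4 x' y') :
    CC1 D ν t1 t2 t3 t4 (r * x + s * x') (r * y + s * y') :=
  ⟨lin_dvd r s h.1 h'.1, lin_dvd r s h.2 h'.2⟩

theorem CC2.lin {D ν t1 t2 t3 t4 x y x' y' : ℤ} (r s : ℤ) (h : CC2 D ν t1 t2 t3 t4 x y)
    (h' : CC2 D ν t1 t2 t3 t4 x' y') :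
    CC2 D ν t1 t2 t3 t4 (r * x + s * x') (r * y + s * y') :=
  ⟨lin_dvd r s h.1 h'.1, lin_dvd r s h.2 h'.2⟩

theorem CC3.lin {D ν t1 t2 t3 t4 x y x' y' : ℤ} (r s : ℤ) (h : CC3 D ν t1 t2 t3 t4 x y)
    (h' : CC3 D ν t1 t2 t3 t4 x' y') :
    CC3 D ν t1 t2 t3 t4 (r * x + s * x') (r * y + s * y') :=
  ⟨lin_dvd r s h.1 h'.1, lin_dvd r s h.2 h'.2⟩

def Par (D ν : ℤ) : Prop := (D = 2 ∧ ν = 2) ∨ (D = 2 ∧ ν = 4) ∨ (D = 4 ∧ ν = 8)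

def Cov (D ν t1 t2 t3 t4 : ℤ) : Prop := ∀ x y : ℤ, D ∣ x ∨ CC1 D ν t1 t2 t3 t4 x y ∨
  CC2 D ν t1 t2 t3 t4 x y ∨ CC3 D ν t1 t2 t3 t4 x y

theorem Par.two_dvd {D ν : ℤ} (h : Par D ν) : (2 : ℤ) ∣ D := by
  rcases h with h | h | h <;> rw [h.1] <;> norm_num

/-- Case A: odd determinant. -/
theorem caseA {D ν t1 t2 t3 t4 : ℤ} (hP : Par D ν) (hc : Cov D ν t1 t2 t3 t4)
    (hodd : Odd (t1 * t4 - t2 * t3)) : False := by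
  have h2 : (2 : ℤ) ∣ (t1 * t4 - t2 * t3) * D := hP.two_dvd.mul_left _
  have key : ∀ k : ℤ, Even (t1 * t2 + t3 * t4 + (t2 + t4) * k) := by
    intro k
    rcases hc 1 k with h | h | h | h
    · exact absurd (hP.two_dvd.trans h) (by norm_num)
    · have := even_iff_two_dvd.2 (h2.trans h.1)
      revert this; simp [parity_simps]
    · have := even_iff_two_dvd.2 (h2.trans h.1)
      revert this; simp [parity_simps]; tauto
    · have := even_iff_two_dvd.2 (h2.trans h.1)
      exfalso
      revert this hodd; simp [parity_simps, ← Int.not_even_iff_odd]; tauto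
  have k0 := key 0
  have k1 := key 1
  revert k0 k1 hodd
  simp [parity_simps, ← Int.not_even_iff_odd]
  tauto

/-- Three points on a line, two alternatives. -/
theorem caseB {D ν t1 t2 t3 t4 : ℤ} (hP : Par D ν) (hc : Cov D ν t1 t2 t3 t4)
    (h3 : Even t3) (h4 : Even t4) (h2 : Odd t2)
    (p3 : ¬ ∀ x y, CC3 D ν t1 t2 t3 t4 x y) : False := by
  have hD : (2 : ℤ) ∣ (t1 * t4 - t2 * t3) * D := hP.two_dvd.mul_left _
  have e1 : ∀ k, CC1 D ν t1 t2 t3 t4 1 k → Even (t1 + k) := by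
    intro k h
    have := even_iff_two_dvd.2 (hD.trans h.1)
    revert this h2; simp [parity_simps, h3, h4, ← Int.not_even_iff_odd]; tauto
  have e2 : ∀ k, CC2 D ν t1 t2 t3 t4 1 k → Even (t1 + k) := by
    intro k h
    have := even_iff_two_dvd.2 (hD.trans h.1)
    revert this h2; simp [parity_simps, h3, h4, ← Int.not_even_iff_odd]; tauto
  have n0 : ¬ D ∣ 1 := fun h => absurd (hP.two_dvd.trans h) (by norm_num)
  have c3 : ∀ k, Odd (t1 + k) → CC3 D ν t1 t2 t3 t4 1 k := by
    intro k hk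
    rw [← Int.not_even_iff_odd] at hk
    rcases hc 1 k with h | h | h | h
    · exact absurd h n0
    · exact absurd (e1 k h) hk
    · exact absurd (e2 k h) hk
    · exact h
  have n3 : ∀ k, Even (t1 + k) → ¬ CC3 D ν t1 t2 t3 t4 1 k := by
    intro k hk h
    have h' := c3 (k + 1) (by rw [← add_assoc]; exact hk.add_one)
    apply p3
    intro x y
    have := CC3.lin (x - (y - x * k)) (y - x * k) h h'
    convert this using 1 <;> ring
  have c12 : ∀ k, Even (t1 + k) → CC1 D ν t1 t2 t3 t4 1 k ∨ CC2 D ν t1 t2 t3 t4 1 k := by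
    intro k hk
    rcases hc 1 k with h | h | h | h
    · exact absurd h n0
    · exact Or.inl h
    · exact Or.inr h
    · exact absurd h (n3 k hk)
  have d1 : ∀ k l, k ∣ 4 → CC1 D ν t1 t2 t3 t4 1 l → CC1 D ν t1 t2 t3 t4 1 (l + k) →
      (t1 * t4 - t2 * t3) * D ∣ 4 * (t2 ^ 2 + t4 ^ 2) := by
    rintro k l ⟨m, hm⟩ h h'
    have := (CC1.lin (-m) m h h').1
    convert this using 1
    rw [hm]; ring
  have d2 : ∀ k l, k ∣ 4 → CC2 D ν t1 t2 t3 t4 1 l → CC2 D ν t1 t2 t3 t4 1 (l + k) →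
      (t1 * t4 - t2 * t3) * D ∣ 4 * (t4 ^ 2 - t2 ^ 2) := by
    rintro k l ⟨m, hm⟩ h h'
    have := (CC2.lin (-m) m h h').1
    convert this using 1
    rw [hm]; ring
  have main : ∃ e, Odd e ∧ (t1 * t4 - t2 * t3) * D ∣ 4 * e := by
    have o1 : Odd (t2 ^ 2 + t4 ^ 2) := by
      simp [parity_simps, h4, h2]
    have o2 : Odd (t4 ^ 2 - t2 ^ 2) :=
      (h4.pow_of_ne_zero two_ne_zero).sub_odd h2.pow
    have q0 := c12 t1 (by simp)
    have q2 := c12 (t1 + 2) (by simp [parity_simps])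
    have q4 := c12 (t1 + 2 + 2) (by simp [parity_simps])
    have r4 : t1 + 2 + 2 = t1 + 4 := by ring
    rcases q0 with q0 | q0 <;> rcases q2 with q2 | q2
    · exact ⟨_, o1, d1 2 _ (by norm_num) q0 q2⟩
    · rcases q4 with q4 | q4
      · exact ⟨_, o1, d1 4 _ (by norm_num) q0 (r4 ▸ q4)⟩
      · exact ⟨_, o2, d2 2 _ (by norm_num) q2 q4⟩
    · rcases q4 with q4 | q4
      · exact ⟨_, o1, d1 2 _ (by norm_num) q2 q4⟩
      · exact ⟨_, o2, d2 4 _ (by norm_num) q0 (r4 ▸ q4)⟩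
    · exact ⟨_, o2, d2 2 _ (by norm_num) q0 q2⟩
  obtain ⟨e, he, hde⟩ := main
  obtain ⟨a, ha⟩ := even_iff_two_dvd.1 h3
  obtain ⟨b, hb⟩ := even_iff_two_dvd.1 h4
  have hdet : t1 * t4 - t2 * t3 = 2 * (t1 * b - t2 * a) := by rw [ha, hb]; ring
  have c := (c3 (t1 + 1) ⟨t1, by ring⟩).1
  rw [hdet] at hde c
  have hD2 : D = 2 ∨ D = 4 := by unfold Par at hP; tauto
  rcases hD2 with rfl | rfl
  · have m1 : (t1 * b - t2 * a) ∣ e := by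
      have : 4 * (t1 * b - t2 * a) ∣ 4 * e := by convert hde using 1; ring
      exact (mul_dvd_mul_iff_left (by norm_num)).1 this
    have m2 : Odd (t1 * b - t2 * a) := odd_of_dvd_aux he m1
    have m3 : (4 : ℤ) ∣ 2 * (t2 * a + t1 * b) + 4 * (t2 * b * (t1 + 1)) := by
      refine Dvd.dvd.trans ⟨t1 * b - t2 * a, by ring⟩ (c.trans (dvd_of_eq ?_))
      rw [ha, hb]; ring
    have m4 : Even (t2 * a + t1 * b) := by rw [even_iff_two_dvd]; omega
    revert m2 m4; simp [parity_simps, ← Int.not_even_iff_odd]; tauto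
  · have : (8 : ℤ) ∣ 4 * e := Dvd.dvd.trans ⟨t1 * b - t2 * a, by ring⟩ hde
    obtain ⟨f, rfl⟩ := he
    omega

theorem sat_aux {m A B x y : ℤ} (ho : Odd m) (hA : 4 ∣ A) (hB : 4 ∣ B)
    (h : 2 * m * 2 ∣ A * (2 * x) + B * (2 * y)) : 2 * m * 2 ∣ A * x + B * y := by
  obtain ⟨a, rfl⟩ := hA
  obtain ⟨b, rfl⟩ := hB
  have h1 : m ∣ 2 * (a * x + b * y) := by
    have : 4 * m ∣ 4 * (2 * (a * x + b * y)) := by convert h using 1 <;> ring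
    exact (mul_dvd_mul_iff_left (by norm_num)).1 this
  have h2 : IsCoprime m 2 := by
    obtain ⟨k, rfl⟩ := ho
    exact ⟨1, -k, by ring⟩
  obtain ⟨k, hk⟩ := h2.dvd_of_dvd_mul_left h1
  exact ⟨k, by linear_combination 4 * hk⟩

theorem caseC {D ν t1 t2 t3 t4 : ℤ} (hP : Par D ν) (hc : Cov D ν t1 t2 t3 t4)
    (h3 : Even t3) (h4 : Even t4) (h2 : Even t2) (h1 : Odd t1)
    (p1 : ¬ ∀ x y, CC1 D ν t1 t2 t3 t4 x y)
    (p2 : ¬ ∀ x y, CC2 D ν t1 t2 t3 t4 x y)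
    (p3 : ¬ ∀ x y, CC3 D ν t1 t2 t3 t4 x y) : False := by
  have n0 : ¬ D ∣ 1 := fun h => absurd (hP.two_dvd.trans h) (by norm_num)
  obtain ⟨a, ha⟩ := even_iff_two_dvd.1 h3
  obtain ⟨b, hb⟩ := even_iff_two_dvd.1 h4
  obtain ⟨c, hc2⟩ := even_iff_two_dvd.1 h2
  have hdet : t1 * t4 - t2 * t3 = 2 * (t1 * b - 2 * c * a) := by rw [ha, hb, hc2]; ring
  by_cases H : ∀ g, (t1 * t4 - t2 * t3) * D ∣ ν * g → Even g
  · have c3 : ∀ k, CC3 D ν t1 t2 t3 t4 1 k := by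
      intro k
      rcases hc 1 k with h | h | h | h
      · exact absurd h n0
      · exfalso
        have := H ((t1 ^ 2 + t3 ^ 2) * 1 + (t1 * t2 + t3 * t4) * k) (by
          convert h.2 using 1; ring)
        revert this h1; simp [parity_simps, h2, h3, h4]
      · exfalso
        have := H ((t1 ^ 2 - t3 ^ 2) * 1 + (t1 * t2 - t3 * t4) * k) (by
          convert h.2 using 1; ring)
        revert this h1; simp [parity_simps, h2, h3, h4]
      · exact h
    apply p3
    intro x y
    have := CC3.lin (x - y) y (c3 0) (c3 1)
    convert this using 1 <;> ring
  have hν : ν = 2 * D ∧ Odd (t1 * b - 2 * c * a) := by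
    push Not at H
    obtain ⟨g, hg, hg'⟩ := H
    rw [hdet] at hg
    rw [Int.not_even_iff_odd] at hg'
    rcases hP with ⟨rfl, rfl⟩ | ⟨rfl, rfl⟩ | ⟨rfl, rfl⟩
    · exfalso
      have : (4 : ℤ) ∣ 2 * g := Dvd.dvd.trans ⟨t1 * b - 2 * c * a, by ring⟩ hg
      obtain ⟨f, rfl⟩ := hg'
      omega
    · refine ⟨rfl, odd_of_dvd_aux hg' ?_⟩
      have : 4 * (t1 * b - 2 * c * a) ∣ 4 * g := by convert hg using 1; ring
      exact (mul_dvd_mul_iff_left (by norm_num)).1 this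
    · refine ⟨rfl, odd_of_dvd_aux hg' ?_⟩
      have : 8 * (t1 * b - 2 * c * a) ∣ 8 * g := by convert hg using 1; ring
      exact (mul_dvd_mul_iff_left (by norm_num)).1 this
  obtain ⟨hν, hmo⟩ := hν
  have h4D : (4 : ℤ) ∣ (t1 * t4 - t2 * t3) * D := by
    obtain ⟨e, he⟩ := hP.two_dvd
    rw [hdet, he]
    exact ⟨(t1 * b - 2 * c * a) * e, by ring⟩
  have hbo : Odd b := by
    revert hmo; simp [parity_simps, ← Int.not_even_iff_odd]
  have c12 : ∀ k, CC1 D ν t1 t2 t3 t4 1 k ∨ CC2 D ν t1 t2 t3 t4 1 k := by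
    intro k
    rcases hc 1 k with h | h | h | h
    · exact absurd h n0
    · exact Or.inl h
    · exact Or.inr h
    · exfalso
      have h5 := h4D.trans h.1
      have h6 : (4 : ℤ) ∣ 2 * (t2 * a + t1 * b) + 4 * (t2 * b * k) := by
        refine h5.trans (dvd_of_eq ?_); rw [ha, hb]; ring
      have h7 : Even (t2 * a + t1 * b) := by rw [even_iff_two_dvd]; omega
      revert h7 h1 hbo; simp [parity_simps, h2, ← Int.not_even_iff_odd]; tauto
  have hce : Even c := by
    have h5 : (4 : ℤ) ∣ 2 * (t1 * c) + 4 * (a * b) ∨ (4 : ℤ) ∣ - 2 * (t1 * c) + 4 * (a * b) := by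
      rcases c12 0 with h | h
      · left; refine (h4D.trans h.1).trans (dvd_of_eq ?_); rw [ha, hb, hc2]; ring
      · right; refine (h4D.trans h.1).trans (dvd_of_eq ?_); rw [ha, hb, hc2]; ring
    have h7 : Even (t1 * c) := by rw [even_iff_two_dvd]; omega
    revert h7 h1; simp [parity_simps, ← Int.not_even_iff_odd]; tauto
  obtain ⟨c', hc'⟩ := even_iff_two_dvd.1 hce
  have hD2 : D = 2 ∨ D = 4 := by unfold Par at hP; tauto
  rcases hD2 with rfl | rfl
  · -- D = 2
    subst hν
    have s1 : ∀ x y, CC1 2 (2 * 2) t1 t2 t3 t4 (2 * x) (2 * y) →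
        CC1 2 (2 * 2) t1 t2 t3 t4 x y := by
      intro x y h
      unfold CC1 at h ⊢
      rw [hdet] at h ⊢
      refine ⟨sat_aux hmo ?_ ?_ h.1, sat_aux hmo ?_ ?_ h.2⟩
      · rw [ha, hb, hc2, hc']; exact ⟨t1 * c' + a * b, by ring⟩
      · rw [hb, hc2]; exact ⟨c ^ 2 + b ^ 2, by ring⟩
      · exact ⟨t1 ^ 2 + t3 ^ 2, by ring⟩
      · exact ⟨t1 * t2 + t3 * t4, by ring⟩
    have s2 : ∀ x y, CC2 2 (2 * 2) t1 t2 t3 t4 (2 * x) (2 * y) →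
        CC2 2 (2 * 2) t1 t2 t3 t4 x y := by
      intro x y h
      unfold CC2 at h ⊢
      rw [hdet] at h ⊢
      refine ⟨sat_aux hmo ?_ ?_ h.1, sat_aux hmo ?_ ?_ h.2⟩
      · rw [ha, hb, hc2, hc']; exact ⟨a * b - t1 * c', by ring⟩
      · rw [hb, hc2]; exact ⟨b ^ 2 - c ^ 2, by ring⟩
      · exact ⟨t1 ^ 2 - t3 ^ 2, by ring⟩
      · exact ⟨t1 * t2 - t3 * t4, by ring⟩
    have d1 : ∀ k l, l ∣ 2 → CC1 2 (2 * 2) t1 t2 t3 t4 1 k →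
        CC1 2 (2 * 2) t1 t2 t3 t4 1 (k + l) → False := by
      rintro k l ⟨r, hr⟩ h h'
      apply p1
      intro x y
      apply s1
      have := CC1.lin (2 * x - r * (y - x * k)) (r * (y - x * k)) h h'
      convert this using 1
      · ring
      · linear_combination (y - x * k) * hr
    have d2 : ∀ k l, l ∣ 2 → CC2 2 (2 * 2) t1 t2 t3 t4 1 k →
        CC2 2 (2 * 2) t1 t2 t3 t4 1 (k + l) → False := by
      rintro k l ⟨r, hr⟩ h h'
      apply p2
      intro x y
      apply s2
      have := CC2.lin (2 * x - r * (y - x * k)) (r * (y - x * k)) h h'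
      convert this using 1
      · ring
      · linear_combination (y - x * k) * hr
    have q0 := c12 0
    have q1 := c12 (0 + 1)
    have q2 := c12 (0 + 2)
    have r2 : (0 + 2 : ℤ) = 0 + 1 + 1 := by norm_num
    rcases q0 with q0 | q0 <;> rcases q1 with q1 | q1 <;> rcases q2 with q2 | q2
    · exact d1 0 1 (by norm_num) q0 q1
    · exact d1 0 1 (by norm_num) q0 q1
    · exact d1 0 2 (by norm_num) q0 q2
    · exact d2 (0 + 1) 1 (by norm_num) q1 (r2 ▸ q2)
    · exact d1 (0 + 1) 1 (by norm_num) q1 (r2 ▸ q2)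
    · exact d2 0 2 (by norm_num) q0 q2
    · exact d2 0 1 (by norm_num) q0 q1
    · exact d2 0 1 (by norm_num) q0 q1
  · -- D = 4
    have h8 : (8 : ℤ) ∣ (t1 * t4 - t2 * t3) * 4 := by
      rw [hdet]; exact ⟨t1 * b - 2 * c * a, by ring⟩
    have par : ∀ k, Even (t1 * c' + a * b + k) := by
      intro k
      rcases c12 k with h | h
      · have h5 : (8 : ℤ) ∣ 4 * (t1 * c' + a * b + (4 * c' ^ 2 + b ^ 2) * k) := by
          refine (h8.trans h.1).trans (dvd_of_eq ?_); rw [ha, hb, hc2, hc']; ring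
        have h7 : Even (t1 * c' + a * b + (4 * c' ^ 2 + b ^ 2) * k) := by
          rw [even_iff_two_dvd]; omega
        have h9 : Even (4 : ℤ) := by decide
        revert h7 hbo; simp [parity_simps, h9, ← Int.not_even_iff_odd]; tauto
      · have h5 : (8 : ℤ) ∣ 4 * (a * b - t1 * c' + (b ^ 2 - 4 * c' ^ 2) * k) := by
          refine (h8.trans h.1).trans (dvd_of_eq ?_); rw [ha, hb, hc2, hc']; ring
        have h7 : Even (a * b - t1 * c' + (b ^ 2 - 4 * c' ^ 2) * k) := by
          rw [even_iff_two_dvd]; omega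
        have h9 : Even (4 : ℤ) := by decide
        revert h7 hbo; simp [parity_simps, h9, ← Int.not_even_iff_odd]; tauto
    have k0 := par 0
    have k1 := par 1
    obtain ⟨u, hu⟩ := k0
    obtain ⟨v, hv⟩ := k1
    omega

theorem CC1.swap {D ν t1 t2 t3 t4 x y : ℤ} :
    CC1 D ν t3 t4 t1 t2 x y ↔ CC1 D ν t1 t2 t3 t4 x y := by
  unfold CC1
  rw [show (t3 * t2 - t4 * t1) * D = -((t1 * t4 - t2 * t3) * D) by ring, neg_dvd, neg_dvd]
  refine and_congr (iff_of_eq ?_) (iff_of_eq ?_) <;> congr 1 <;> ring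

theorem CC2.swap {D ν t1 t2 t3 t4 x y : ℤ} :
    CC2 D ν t3 t4 t1 t2 x y ↔ CC2 D ν t1 t2 t3 t4 x y := by
  unfold CC2
  rw [show (t3 * t2 - t4 * t1) * D = -((t1 * t4 - t2 * t3) * D) by ring, neg_dvd, neg_dvd]
  refine and_congr ?_ ?_ <;> rw [← dvd_neg] <;> refine iff_of_eq ?_ <;> congr 1 <;> ring

theorem CC3.swap {D ν t1 t2 t3 t4 x y : ℤ} :
    CC3 D ν t3 t4 t1 t2 x y ↔ CC3 D ν t1 t2 t3 t4 x y := by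
  unfold CC3
  rw [show (t3 * t2 - t4 * t1) * D = -((t1 * t4 - t2 * t3) * D) by ring, neg_dvd, neg_dvd]
  refine and_congr (iff_of_eq ?_) (iff_of_eq ?_) <;> congr 1 <;> ring

theorem main1 {D ν t1 t2 t3 t4 : ℤ} (hP : Par D ν) (hc : Cov D ν t1 t2 t3 t4)
    (hn : ¬ (Even (t1 + t3) ∧ Even (t2 + t4)))
    (p1 : ¬ ∀ x y, CC1 D ν t1 t2 t3 t4 x y)
    (p2 : ¬ ∀ x y, CC2 D ν t1 t2 t3 t4 x y)
    (p3 : ¬ ∀ x y, CC3 D ν t1 t2 t3 t4 x y) : False := by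
  by_cases hd : Odd (t1 * t4 - t2 * t3)
  · exact caseA hP hc hd
  have hs : (Even t3 ∧ Even t4) ∨ (Even t1 ∧ Even t2) := by
    revert hd hn; simp [parity_simps, ← Int.not_even_iff_odd]; tauto
  rcases hs with ⟨h3, h4⟩ | ⟨h1, h2⟩
  · by_cases h2 : Even t2
    · have h1 : Odd t1 := by
        revert hn; simp [parity_simps, h2, h3, h4]
      exact caseC hP hc h3 h4 h2 h1 p1 p2 p3
    · exact caseB hP hc h3 h4 (Int.not_even_iff_odd.1 h2) p3
  · have hc' : Cov D ν t3 t4 t1 t2 := by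
      intro x y
      rw [CC1.swap, CC2.swap, CC3.swap]
      exact hc x y
    simp only [← CC1.swap (t1 := t1)] at p1
    simp only [← CC2.swap (t1 := t1)] at p2
    simp only [← CC3.swap (t1 := t1)] at p3
    by_cases h4 : Even t4
    · have h3 : Odd t3 := by
        revert hn; simp [parity_simps, h1, h2, h4]
      exact caseC hP hc' h1 h2 h4 h3 p1 p2 p3
    · exact caseB hP hc' h1 h2 (Int.not_even_iff_odd.1 h4) p3

theorem two_aux {n m a b : ℤ} (hn : n = -(2 * m)) (ha : a = 2 * b ∨ a = -(2 * b)) :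
    n ∣ a ↔ m ∣ b := by
  subst hn
  rw [neg_dvd]
  rcases ha with rfl | rfl
  · exact mul_dvd_mul_iff_left (by norm_num)
  · rw [dvd_neg]; exact mul_dvd_mul_iff_left (by norm_num)

theorem CC1.rot {D ν p1 p2 p3 p4 x y : ℤ} :
    CC1 D ν (p1 + p3) (p2 + p4) (p1 - p3) (p2 - p4) x y ↔ CC1 D ν p1 p2 p3 p4 x y :=
  and_congr (two_aux (by ring) (Or.inl (by ring))) (two_aux (by ring) (Or.inl (by ring)))

theorem CC2.rot {D ν p1 p2 p3 p4 x y : ℤ} :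
    CC2 D ν (p1 + p3) (p2 + p4) (p1 - p3) (p2 - p4) x y ↔ CC3 D ν p1 p2 p3 p4 x y :=
  and_congr (two_aux (by ring) (Or.inr (by ring))) (two_aux (by ring) (Or.inl (by ring)))

theorem CC3.rot {D ν p1 p2 p3 p4 x y : ℤ} :
    CC3 D ν (p1 + p3) (p2 + p4) (p1 - p3) (p2 - p4) x y ↔ CC2 D ν p1 p2 p3 p4 x y :=
  and_congr (two_aux (by ring) (Or.inr (by ring))) (two_aux (by ring) (Or.inl (by ring)))

theorem main2 {D ν t1 t2 t3 t4 : ℤ} (hP : Par D ν) (hc : Cov D ν t1 t2 t3 t4)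
    (hn : ¬ (Even t1 ∧ Even t2 ∧ Even t3 ∧ Even t4))
    (p1 : ¬ ∀ x y, CC1 D ν t1 t2 t3 t4 x y)
    (p2 : ¬ ∀ x y, CC2 D ν t1 t2 t3 t4 x y)
    (p3 : ¬ ∀ x y, CC3 D ν t1 t2 t3 t4 x y) : False := by
  by_cases hs : Even (t1 + t3) ∧ Even (t2 + t4)
  · obtain ⟨⟨u, hu⟩, ⟨v, hv⟩⟩ := hs
    obtain ⟨q1, q3, e1, e3⟩ : ∃ q1 q3, t1 = q1 + q3 ∧ t3 = q1 - q3 :=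
      ⟨u, t1 - u, by ring, by linarith⟩
    obtain ⟨q2, q4, e2, e4⟩ : ∃ q2 q4, t2 = q2 + q4 ∧ t4 = q2 - q4 :=
      ⟨v, t2 - v, by ring, by linarith⟩
    subst e1 e2 e3 e4
    unfold Cov at hc
    simp only [CC1.rot, CC2.rot, CC3.rot] at hc p1 p2 p3
    refine main1 hP (fun x y => ?_) ?_ p1 p3 p2
    · have := hc x y
      tauto
    · rintro ⟨h, h'⟩
      apply hn
      refine ⟨h, h', ?_, ?_⟩
      · revert h; simp [parity_simps]
      · revert h'; simp [parity_simps]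
  · exact main1 hP hc hs p1 p2 p3

/-- There are no `(D,ν) ∈ {(2,2),(2,4),(4,8)}` and integers `t₁,t₂,t₃,t₄` with
`gcd = 1`, `d₂ ≠ 0`, such that the four lattices `Λ₀, Λ₁, Λ₂, Λ₃` cover ℤ² while none
of them equals ℤ². -/
theorem lattice_covering_stmt (D ν t1 t2 t3 t4 : ℤ)
    (hDν : (D, ν) = (2, 2) ∨ (D, ν) = (2, 4) ∨ (D, ν) = (4, 8))
    (hgcd : Int.gcd (Int.gcd (Int.gcd t1 t2) t3) t4 = 1)
    (hd2 : t1 * t4 - t2 * t3 ≠ 0)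
    (hcover : ∀ p : ℤ × ℤ, p ∈ Lam0 D ν ∨ p ∈ Lam1 D ν t1 t2 t3 t4 ∨
      p ∈ Lam2 D ν t1 t2 t3 t4 ∨ p ∈ Lam3 D ν t1 t2 t3 t4)
    (hproper : Lam0 D ν ≠ ⊤ ∧ Lam1 D ν t1 t2 t3 t4 ≠ ⊤ ∧
      Lam2 D ν t1 t2 t3 t4 ≠ ⊤ ∧ Lam3 D ν t1 t2 t3 t4 ≠ ⊤) :
    False := by
  have habs : ∀ z : ℤ, |t1 * t4 - t2 * t3| * D ∣ z ↔ (t1 * t4 - t2 * t3) * D ∣ z := by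
    intro z
    rcases abs_choice (t1 * t4 - t2 * t3) with h | h <;> rw [h]
    rw [neg_mul, neg_dvd]
  have m1 : ∀ p : ℤ × ℤ, p ∈ Lam1 D ν t1 t2 t3 t4 ↔ CC1 D ν t1 t2 t3 t4 p.1 p.2 :=
    fun p => and_congr (habs _) (habs _)
  have m2 : ∀ p : ℤ × ℤ, p ∈ Lam2 D ν t1 t2 t3 t4 ↔ CC2 D ν t1 t2 t3 t4 p.1 p.2 :=
    fun p => and_congr (habs _) (habs _)
  have m3 : ∀ p : ℤ × ℤ, p ∈ Lam3 D ν t1 t2 t3 t4 ↔ CC3 D ν t1 t2 t3 t4 p.1 p.2 :=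
    fun p => and_congr (habs _) (habs _)
  have m0 : ∀ p : ℤ × ℤ, p ∈ Lam0 D ν → D ∣ p.1 := by
    intro p hp
    have h : D ∣ 1 * p.1 + 0 * p.2 := hp.1
    simpa using h
  have hP : Par D ν := by simpa [Par, Prod.ext_iff] using hDν
  obtain ⟨-, q1, q2, q3⟩ := hproper
  refine main2 (D := D) (ν := ν) (t1 := t1) (t2 := t2) (t3 := t3) (t4 := t4) hP ?_ ?_ ?_ ?_ ?_
  · intro x y
    rcases hcover (x, y) with h | h | h | h
    · exact Or.inl (m0 _ h)
    · exact Or.inr (Or.inl ((m1 _).1 h))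
    · exact Or.inr (Or.inr (Or.inl ((m2 _).1 h)))
    · exact Or.inr (Or.inr (Or.inr ((m3 _).1 h)))
  · rintro ⟨h1, h2, h3, h4⟩
    rw [even_iff_two_dvd] at h1 h2 h3 h4
    have := Int.dvd_coe_gcd (Int.dvd_coe_gcd (Int.dvd_coe_gcd h1 h2) h3) h4
    rw [hgcd] at this
    norm_num at this
  · exact fun h => q1 ((AddSubgroup.eq_top_iff' _).2 fun p => (m1 p).2 (h _ _))
  · exact fun h => q2 ((AddSubgroup.eq_top_iff' _).2 fun p => (m2 p).2 (h _ _))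
  · exact fun h => q3 ((AddSubgroup.eq_top_iff' _).2 fun p => (m3 p).2 (h _ _))
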